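/- Let (W, S) be a Coxeter system, and call a reflection any element of the form usu⁻¹ with u ∈ W and s ∈ S; for w ∈ W let ℓ_T(w) denote the reflection length of w, i.e. the least k ≥ 0 such that w is a product of k reflections. Let l = [s_{i₁}, …, s_{i_b}] be a list of pairwise distinct simple reflections with product w, and let l' be a sublist of l of length k with product w'. Then ℓ_T(w·w'⁻¹) = b − k. -/

import Mathlib

/-- The reflection length of `w` in a Coxeter system: the least `k` such that `w` can be
written as a product of `k` reflections (conjugates of simple reflections). -/
noncomputable def reflectionLength {B W : Type*} [Group W] {M : CoxeterMatrix B}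
    (cs : CoxeterSystem M W) (w : W) : ℕ :=
  sInf {k : ℕ | ∃ l : List W, l.length = k ∧ (∀ t ∈ l, cs.IsReflection t) ∧ l.prod = w}

open Module in
theorem aux_pow {V : Type*} [AddCommGroup V] [Module ℝ V] {x y : V} {f g : Dual ℝ V}
    (hf : f x = 2) (hg : g y = 2) (m : ℕ) (hm : m ≠ 1)
    (h1 : f y = -2 * Real.cos (Real.pi / m)) (h2 : g x = -2 * Real.cos (Real.pi / m)) :
    (reflection hf * reflection hg) ^ m = 1 := by
  rcases Nat.lt_or_ge m 3 with hlt | hge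
  · interval_cases m
    · simp
    · exact absurd rfl hm
    · have h1' : f y = 0 := by rw [h1]; simp
      have h2' : g x = 0 := by rw [h2]; simp
      ext z
      simp only [pow_two, LinearEquiv.mul_apply, reflection_apply, map_sub, map_smul, h1', h2',
        hf, hg, LinearEquiv.coe_one, id, smul_eq_mul]
      module
  · have hm0 : (0 : ℝ) < m := by positivity
    have hm3 : (3 : ℝ) ≤ m := by exact_mod_cast hge
    set θ : ℝ := 2 * (Real.pi / m) with hθ
    have hs : Real.sin θ ≠ 0 := by
      apply ne_of_gt
      apply Real.sin_pos_of_pos_of_lt_pi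
      · positivity
      · rw [hθ, ← mul_div_assoc, div_lt_iff₀ hm0]
        nlinarith [Real.pi_pos]
    have ht : 2 * Real.cos θ = f y * g x - 2 := by
      rw [h1, h2, hθ, Real.cos_two_mul]; ring
    have hS : ∀ n : ℤ, (Polynomial.Chebyshev.S ℝ n).eval (2 * Real.cos θ)
        = Real.sin ((n + 1) * θ) / Real.sin θ := by
      intro n
      rw [eq_div_iff hs, Polynomial.Chebyshev.S_two_mul_real_cos]
    ext z
    rw [reflection_mul_reflection_pow_apply hf hg m z _ ht]
    rcases Nat.even_or_odd' m with ⟨k, hk | hk⟩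
    · have e1 : ((m : ℤ) - 2) / 2 = k - 1 := by omega
      have e2 : ((m : ℤ) - 1) / 2 = k - 1 := by omega
      have hz : (Polynomial.Chebyshev.S ℝ ((k : ℤ) - 1)).eval (2 * Real.cos θ) = 0 := by
        rw [hS]
        have : ((((k : ℤ) - 1 : ℤ) : ℝ) + 1) * θ = Real.pi := by
          have : (m : ℝ) = 2 * k := by exact_mod_cast hk
          push_cast
          rw [hθ]
          field_simp
          linarith
        rw [this]; simp
      rw [e1, e2, hz]
      simp
    · have e1 : ((m : ℤ) - 2) / 2 = k - 1 := by omega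
      have e2 : ((m : ℤ) - 1) / 2 = k := by omega
      have e3 : ((m : ℤ) - 3) / 2 = k - 1 := by omega
      have e4 : (m : ℤ) / 2 = k := by omega
      have hz : (Polynomial.Chebyshev.S ℝ (k : ℤ)).eval (2 * Real.cos θ)
          + (Polynomial.Chebyshev.S ℝ ((k : ℤ) - 1)).eval (2 * Real.cos θ) = 0 := by
        rw [hS, hS, ← add_div]
        have hmk : (m : ℝ) = 2 * k + 1 := by exact_mod_cast hk
        have : (((k : ℤ) : ℝ) + 1) * θ = 2 * Real.pi - ((((k : ℤ) - 1 : ℤ) : ℝ) + 1) * θ := by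
          push_cast
          rw [hθ]
          field_simp
          linarith
        rw [this, Real.sin_two_pi_sub]; simp
      rw [e1, e2, e3, e4, hz]
      simp

/-- coroot functional -/
noncomputable def auxF {B : Type*} (M : CoxeterMatrix B) (i : B) :
    Module.Dual ℝ ((B →₀ ℝ) × (B →₀ ℝ)) :=
  (Finsupp.linearCombination ℝ (fun j => -2 * Real.cos (Real.pi / M i j))).comp
    (LinearMap.fst ℝ _ _) + (Finsupp.lapply i).comp (LinearMap.snd ℝ _ _)

/-- root vector -/
noncomputable def auxR {B : Type*} (i : B) : (B →₀ ℝ) × (B →₀ ℝ) := (Finsupp.single i 1, 0)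

theorem auxF_auxR {B : Type*} (M : CoxeterMatrix B) (i j : B) :
    auxF M i (auxR j) = -2 * Real.cos (Real.pi / M i j) := by
  simp [auxF, auxR]

theorem auxF_self {B : Type*} (M : CoxeterMatrix B) (i : B) : auxF M i (auxR i) = 2 := by
  rw [auxF_auxR]; simp

theorem aux_liftable {B : Type*} (M : CoxeterMatrix B) :
    M.IsLiftable (fun i => Module.reflection (auxF_self M i)) := by
  intro i j
  by_cases h : i = j
  · subst h
    rw [M.diagonal, pow_one]
    ext1 z
    exact Module.involutive_reflection (auxF_self M i) z
  · exact aux_pow _ _ _ (M.off_diagonal i j h) (auxF_auxR M i j)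
      (by rw [auxF_auxR, M.symmetric])

section
variable {B W : Type*} [Group W] {M : CoxeterMatrix B} (cs : CoxeterSystem M W)

/-- geometric representation -/
noncomputable def auxRho : W →* (((B →₀ ℝ) × (B →₀ ℝ)) ≃ₗ[ℝ] ((B →₀ ℝ) × (B →₀ ℝ))) :=
  cs.lift ⟨_, aux_liftable M⟩

theorem auxRho_simple (i : B) (v : (B →₀ ℝ) × (B →₀ ℝ)) :
    auxRho cs (cs.simple i) v = v - auxF M i v • auxR i := by
  rw [auxRho, cs.lift_apply_simple, Module.reflection_apply]

theorem auxRho_fix (ω : List B) (j : B) (h : j ∉ ω) :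
    auxRho cs (cs.wordProd ω) (0, Finsupp.single j 1) = (0, Finsupp.single j 1) := by
  induction ω with
  | nil => simp
  | cons i ω ih =>
    simp only [List.mem_cons, not_or] at h
    rw [cs.wordProd_cons, map_mul, LinearEquiv.mul_apply, ih h.2, auxRho_simple]
    have : auxF M i (0, Finsupp.single j 1) = 0 := by
      simp [auxF, Finsupp.single_apply, h.1]
    rw [this]; simp

theorem auxRho_range (ω : List B) (h : ω.Nodup) (j : B) (hj : j ∈ ω) :
    ∃ v, auxRho cs (cs.wordProd ω) v - v = auxR j := by
  induction ω with
  | nil => simp at hj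
  | cons i ω ih =>
    rw [List.nodup_cons] at h
    have key : ∃ u, auxRho cs (cs.wordProd (i :: ω)) u - u = auxR i := by
      refine ⟨-(0, Finsupp.single i 1), ?_⟩
      rw [map_neg, cs.wordProd_cons, map_mul, LinearEquiv.mul_apply, auxRho_fix cs ω i h.1,
        auxRho_simple]
      have : auxF M i (0, Finsupp.single i 1) = 1 := by
        simp [auxF]
      rw [this]; module
    by_cases hji : j = i
    · rw [hji]; exact key
    · obtain ⟨v, hv⟩ := ih h.2 (by simpa [hji] using hj)
      obtain ⟨u, hu⟩ := key
      refine ⟨v + auxF M i (auxRho cs (cs.wordProd ω) v) • u, ?_⟩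
      have h1 : auxRho cs (cs.wordProd (i :: ω)) v = auxRho cs (cs.wordProd ω) v
          - auxF M i (auxRho cs (cs.wordProd ω) v) • auxR i := by
        rw [cs.wordProd_cons, map_mul, LinearEquiv.mul_apply, auxRho_simple]
      rw [map_add, map_smul, h1, ← hv, ← hu]
      module

theorem aux_prod_span (l : List W) (hl : ∀ t ∈ l, cs.IsReflection t) :
    ∃ s : Finset ((B →₀ ℝ) × (B →₀ ℝ)), s.card ≤ l.length ∧
      ∀ v, auxRho cs l.prod v - v ∈ Submodule.span ℝ (s : Set ((B →₀ ℝ) × (B →₀ ℝ))) := by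
  classical
  induction l with
  | nil => exact ⟨∅, by simp, by simp⟩
  | cons t l ih =>
    obtain ⟨s, hs, hv⟩ := ih (fun t ht => hl t (by simp [ht]))
    obtain ⟨w, i, rfl⟩ := hl t (by simp)
    refine ⟨insert (auxRho cs w (auxR i)) s, ?_, ?_⟩
    · exact (Finset.card_insert_le _ _).trans (by simpa using hs)
    · intro v
      have e : auxRho cs ((w * cs.simple i * w⁻¹) :: l).prod v - v =
          (auxRho cs l.prod v - v)
          - auxF M i (auxRho cs w⁻¹ (auxRho cs l.prod v)) • auxRho cs w (auxR i) := by
        have : auxRho cs w (auxRho cs w⁻¹ (auxRho cs l.prod v)) = auxRho cs l.prod v := by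
          rw [← LinearEquiv.mul_apply, ← map_mul]; simp
        rw [List.prod_cons, map_mul, map_mul, map_mul, LinearEquiv.mul_apply,
          LinearEquiv.mul_apply, LinearEquiv.mul_apply, auxRho_simple, map_sub, map_smul, this]
        module
      rw [e]
      refine Submodule.sub_mem _ ?_ (Submodule.smul_mem _ _ (Submodule.subset_span (by simp)))
      exact Submodule.span_mono (by simp) (hv v)

theorem auxR_indep : LinearIndependent ℝ (auxR : B → (B →₀ ℝ) × (B →₀ ℝ)) := by
  have h : LinearIndependent ℝ (fun i : B => (Finsupp.single i 1 : B →₀ ℝ)) :=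
    Finsupp.linearIndependent_single_one ℝ B
  exact h.map' (LinearMap.inl ℝ (B →₀ ℝ) (B →₀ ℝ)) (LinearMap.ker_eq_bot.2 LinearMap.inl_injective)

theorem aux_lower (ω : List B) (h : ω.Nodup) (l : List W) (hl : ∀ t ∈ l, cs.IsReflection t)
    (hp : l.prod = cs.wordProd ω) : ω.length ≤ l.length := by
  obtain ⟨s, hs, hv⟩ := aux_prod_span cs l hl
  refine le_trans ?_ hs
  have hi : LinearIndependent ℝ (fun k : Fin ω.length => (auxR (ω.get k) : _ × (B →₀ ℝ))) :=
    auxR_indep.comp _ (List.nodup_iff_injective_get.1 h)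
  have hsub : Submodule.span ℝ (Set.range fun k : Fin ω.length => (auxR (ω.get k) : _ × (B →₀ ℝ)))
      ≤ Submodule.span ℝ (s : Set ((B →₀ ℝ) × (B →₀ ℝ))) := by
    rw [Submodule.span_le]
    rintro _ ⟨k, rfl⟩
    obtain ⟨v, hk⟩ := auxRho_range cs ω h (ω.get k) (List.get_mem _ _)
    have := hv v
    rw [hp, hk] at this
    exact this
  have h1 := finrank_span_eq_card hi
  rw [Fintype.card_fin] at h1
  rw [← h1]
  exact (Submodule.finrank_mono hsub).trans (finrank_span_finset_le_card s)

theorem aux_upper (ω ω' : List B) (hsub : ω'.Sublist ω) :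
    ∃ l : List W, l.length = ω.length - ω'.length ∧ (∀ t ∈ l, cs.IsReflection t) ∧
      l.prod = cs.wordProd ω * (cs.wordProd ω')⁻¹ := by
  induction hsub with
  | slnil => exact ⟨[], by simp⟩
  | @cons l₁ l₂ a hs ih =>
    obtain ⟨l, h1, h2, h3⟩ := ih
    refine ⟨cs.simple a :: l, ?_, ?_, ?_⟩
    · have := hs.length_le
      simp only [List.length_cons]; omega
    · simpa [cs.isReflection_simple] using h2
    · rw [List.prod_cons, h3, cs.wordProd_cons]; group
  | @cons_cons l₁ l₂ a hs ih =>
    obtain ⟨l, h1, h2, h3⟩ := ih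
    refine ⟨l.map (MulAut.conj (cs.simple a)), by simpa using h1, ?_, ?_⟩
    · intro t ht
      obtain ⟨u, hu, rfl⟩ := List.mem_map.1 ht
      exact (h2 u hu).conj _
    · rw [← map_list_prod, h3, cs.wordProd_cons, cs.wordProd_cons, MulAut.conj_apply]; group

end

theorem stmt8 {B W : Type*} [Group W] {M : CoxeterMatrix B} (cs : CoxeterSystem M W)
    (ω ω' : List B) (hω : ω.Nodup) (hsub : ω'.Sublist ω) :
    reflectionLength cs (cs.wordProd ω * (cs.wordProd ω')⁻¹) = ω.length - ω'.length := by
  unfold reflectionLength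
  apply le_antisymm
  · exact Nat.sInf_le (aux_upper cs ω ω' hsub)
  · refine le_csInf ⟨_, aux_upper cs ω ω' hsub⟩ ?_
    rintro k ⟨l, rfl, hl, hp⟩
    have := aux_lower cs ω hω (l ++ ω'.map cs.simple) (by
      intro t ht
      rcases List.mem_append.1 ht with h | h
      · exact hl t h
      · obtain ⟨i, -, rfl⟩ := List.mem_map.1 h
        exact cs.isReflection_simple i) (by
      rw [List.prod_append, hp]
      change _ * cs.wordProd ω' = _
      group)
    simp only [List.length_append, List.length_map] at this
    omega
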